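/- Energy identity for the homogeneous linearized problem with surface tension: suppose σ_+, σ_− > 0 and that for all t ∈ ℝ the following equations hold pointwise: ρ_± ∂_t v_± − μ_± Δ v_± + ∇ q_± = 0 and div v_± = 0 on the closure of Ω_±; q_+ e₃ − μ_+ (𝔻 v_+) e₃ = (ρ_+ g ζ_+ − σ_+ Δ′ ζ_+) e₃ at every point of Σ_+; v_+ = v_− and (q_+ − q_−) e₃ − (μ_+ 𝔻 v_+ − μ_− 𝔻 v_−) e₃ = (ρ̃ g ζ_− + σ_− Δ′ ζ_−) e₃ at every point of Σ_−; ∂_t ζ_+ = (v_+)₃ at x₃ = 1 and ∂_t ζ_− = (v_+)₃ at x₃ = 0; v_−(t, x₁, x₂, −b(x₁,x₂)) = 0 for all (x₁,x₂). Then for every t, the function E(t) := ½ ∫_{Ω_+ ∩ (Q×ℝ)} ρ_+ |v_+|² + ½ ∫_{Ω_− ∩ (Q×ℝ)} ρ_− |v_−|² + ½ ∫_Q ( ρ_+ g ζ_+² + σ_+ |∇′ζ_+|² ) + ½ ∫_Q ( −ρ̃ g ζ_−² + σ_− |∇′ζ_−|² ) is differentiable and satisfies E′(t) = −½ ∫_{Ω_+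 ∩ (Q×ℝ)} μ_+ |𝔻 v_+|² − ½ ∫_{Ω_− ∩ (Q×ℝ)} μ_− |𝔻 v_−|². -/

import Mathlib

open MeasureTheory

/-- Partial derivative `∂ᵢ f` of a scalar function on `ℝ³ = Fin 3 → ℝ`. -/
noncomputable def pd3 (i : Fin 3) (f : (Fin 3 → ℝ) → ℝ) (x : Fin 3 → ℝ) : ℝ :=
  fderiv ℝ f x (Pi.single i 1)

/-- The horizontal Laplacian `Δ′` of a function on `ℝ²`. -/
noncomputable def lap2 (f : ℝ × ℝ → ℝ) (p : ℝ × ℝ) : ℝ :=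
  fderiv ℝ (fun y => fderiv ℝ f y (1, 0)) p (1, 0)
    + fderiv ℝ (fun y => fderiv ℝ f y (0, 1)) p (0, 1)

/-- The periodic cell `Q = [0, 2πL₁] × [0, 2πL₂]`. -/
def Qcell (L₁ L₂ : ℝ) : Set (ℝ × ℝ) :=
  Set.Icc 0 (2 * Real.pi * L₁) ×ˢ Set.Icc 0 (2 * Real.pi * L₂)

/-- One periodic cell of the upper fluid domain `Ω₊ = {0 < x₃ < 1}`. -/
def upCell (L₁ L₂ : ℝ) : Set (Fin 3 → ℝ) :=
  {x | x 0 ∈ Set.Icc 0 (2 * Real.pi * L₁) ∧ x 1 ∈ Set.Icc 0 (2 * Real.pi * L₂) ∧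
    0 < x 2 ∧ x 2 < 1}

/-- One periodic cell of the lower fluid domain `Ω₋ = {−b(x₁,x₂) < x₃ < 0}`. -/
def loCell (L₁ L₂ : ℝ) (b : ℝ × ℝ → ℝ) : Set (Fin 3 → ℝ) :=
  {x | x 0 ∈ Set.Icc 0 (2 * Real.pi * L₁) ∧ x 1 ∈ Set.Icc 0 (2 * Real.pi * L₂) ∧
    -b (x 0, x 1) < x 2 ∧ x 2 < 0}

/-- Horizontal periodicity for functions on `ℝ³ = Fin 3 → ℝ`. -/
def HPer3 {α : Type*} (L₁ L₂ : ℝ) (f : (Fin 3 → ℝ) → α) : Prop :=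
  (∀ x, f (x + (2 * Real.pi * L₁) • (Pi.single 0 1 : Fin 3 → ℝ)) = f x) ∧
  (∀ x, f (x + (2 * Real.pi * L₂) • (Pi.single 1 1 : Fin 3 → ℝ)) = f x)

/-- Horizontal periodicity for functions on `ℝ²`. -/
def HPer2 {α : Type*} (L₁ L₂ : ℝ) (f : ℝ × ℝ → α) : Prop :=
  (∀ p : ℝ × ℝ, f (p.1 + 2 * Real.pi * L₁, p.2) = f p) ∧
  (∀ p : ℝ × ℝ, f (p.1, p.2 + 2 * Real.pi * L₂) = f p)

/-- The vertical unit vector `e₃`. -/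
def e₃ : Fin 3 → ℝ := Pi.single 2 1

section Calc

variable {E : Type*} [NormedAddCommGroup E] [NormedSpace ℝ E]

lemma sm_diff {F : Type*} [NormedAddCommGroup F] [NormedSpace ℝ F] {f : E → F}
    (hf : ContDiff ℝ (⊤ : ℕ∞) f) : Differentiable ℝ f :=
  hf.differentiable (by simp)

lemma sm_dir {f : E → ℝ} (hf : ContDiff ℝ (⊤ : ℕ∞) f) (w : E) :
    ContDiff ℝ (⊤ : ℕ∞) (fun x => fderiv ℝ f x w) :=
  (hf.fderiv_right (m := (⊤ : ℕ∞)) (by simp)).clm_apply contDiff_const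

lemma sm_symm {f : E → ℝ} (hf : ContDiff ℝ (⊤ : ℕ∞) f) (u w : E) (x : E) :
    fderiv ℝ (fun y => fderiv ℝ f y u) x w = fderiv ℝ (fun y => fderiv ℝ f y w) x u := by
  have h := (hf.contDiffAt (x := x)).isSymmSndFDerivAt (by simp; exact WithTop.coe_le_coe.2 (le_top : (2:ℕ∞) ≤ ⊤))
  have hd : DifferentiableAt ℝ (fderiv ℝ f) x :=
    (hf.fderiv_right (m := (⊤ : ℕ∞)) (by simp)).differentiable (by simp) x
  have key : ∀ a c : E, fderiv ℝ (fun y => fderiv ℝ f y a) x c = fderiv ℝ (fderiv ℝ f) x c a := by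
    intro a c
    rw [fderiv_clm_apply hd (by fun_prop)]
    simp
  rw [key, key]
  exact h w u

lemma slice_sm {F : Type*} [NormedAddCommGroup F] [NormedSpace ℝ F] {f : ℝ → E → F}
    (hf : ContDiff ℝ (⊤ : ℕ∞) (Function.uncurry f)) (t : ℝ) :
    ContDiff ℝ (⊤ : ℕ∞) (f t) := by
  have : f t = Function.uncurry f ∘ (fun x => (t, x)) := rfl
  rw [this]
  exact hf.comp (contDiff_const.prodMk contDiff_id)

lemma slice_sm' {F : Type*} [NormedAddCommGroup F] [NormedSpace ℝ F] {f : ℝ → E → F}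
    (hf : ContDiff ℝ (⊤ : ℕ∞) (Function.uncurry f)) (x : E) :
    ContDiff ℝ (⊤ : ℕ∞) (fun s => f s x) := by
  have : (fun s => f s x) = Function.uncurry f ∘ (fun s => (s, x)) := rfl
  rw [this]
  exact hf.comp (contDiff_id.prodMk contDiff_const)

lemma slice_fderiv {f : ℝ → E → ℝ} (hf : ContDiff ℝ (⊤ : ℕ∞) (Function.uncurry f))
    (t : ℝ) (x w : E) :
    fderiv ℝ (f t) x w = fderiv ℝ (Function.uncurry f) (t, x) (0, w) := by
  have h1 : HasFDerivAt (Function.uncurry f) (fderiv ℝ (Function.uncurry f) (t, x)) (t, x) :=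
    (sm_diff hf _).hasFDerivAt
  have h2 : HasFDerivAt (fun y : E => (t, y)) (ContinuousLinearMap.inr ℝ ℝ E) x :=
    hasFDerivAt_prodMk_right t x
  have h3 : HasFDerivAt (f t) _ x := h1.comp x h2
  rw [h3.fderiv]
  simp

lemma slice_deriv {f : ℝ → E → ℝ} (hf : ContDiff ℝ (⊤ : ℕ∞) (Function.uncurry f))
    (t : ℝ) (x : E) :
    deriv (fun s => f s x) t = fderiv ℝ (Function.uncurry f) (t, x) (1, 0) := by
  have h1 : HasFDerivAt (Function.uncurry f) (fderiv ℝ (Function.uncurry f) (t, x)) (t, x) :=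
    (sm_diff hf _).hasFDerivAt
  have h2 : HasFDerivAt (fun s : ℝ => (s, x)) (ContinuousLinearMap.inl ℝ ℝ E) t :=
    hasFDerivAt_prodMk_left t x
  have h3 : HasFDerivAt (fun s => f s x)
      ((fderiv ℝ (Function.uncurry f) (t, x)).comp (ContinuousLinearMap.inl ℝ ℝ E)) t :=
    HasFDerivAt.comp (g := Function.uncurry f) (f := fun s : ℝ => (s, x)) t h1 h2
  rw [h3.hasDerivAt.deriv]
  simp

lemma sm_space {f : ℝ → E → ℝ} (hf : ContDiff ℝ (⊤ : ℕ∞) (Function.uncurry f)) (w : E) :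
    ContDiff ℝ (⊤ : ℕ∞) (Function.uncurry fun t x => fderiv ℝ (f t) x w) := by
  have : (Function.uncurry fun t x => fderiv ℝ (f t) x w)
      = fun z => fderiv ℝ (Function.uncurry f) z (0, w) := by
    ext ⟨t, x⟩
    exact slice_fderiv hf t x w
  rw [this]
  exact sm_dir hf _

lemma sm_time {f : ℝ → E → ℝ} (hf : ContDiff ℝ (⊤ : ℕ∞) (Function.uncurry f)) :
    ContDiff ℝ (⊤ : ℕ∞) (Function.uncurry fun t x => deriv (fun s => f s x) t) := by
  have : (Function.uncurry fun t x => deriv (fun s => f s x) t)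
      = fun z => fderiv ℝ (Function.uncurry f) z (1, 0) := by
    ext ⟨t, x⟩
    exact slice_deriv hf t x
  rw [this]
  exact sm_dir hf _

lemma time_space {f : ℝ → E → ℝ} (hf : ContDiff ℝ (⊤ : ℕ∞) (Function.uncurry f)) (w : E)
    (t : ℝ) (x : E) :
    deriv (fun s => fderiv ℝ (f s) x w) t
      = fderiv ℝ (fun y => deriv (fun s => f s y) t) x w := by
  rw [slice_deriv (f := fun t x => fderiv ℝ (f t) x w) (sm_space hf w)]
  rw [slice_fderiv (f := fun t x => deriv (fun s => f s x) t) (sm_time hf)]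
  have h1 : (Function.uncurry fun t x => fderiv ℝ (f t) x w)
      = fun z => fderiv ℝ (Function.uncurry f) z (0, w) := by
    ext ⟨t, x⟩
    exact slice_fderiv hf t x w
  have h2 : (Function.uncurry fun t x => deriv (fun s => f s x) t)
      = fun z => fderiv ℝ (Function.uncurry f) z (1, 0) := by
    ext ⟨t, x⟩
    exact slice_deriv hf t x
  rw [h1, h2]
  exact sm_symm hf _ _ _

lemma deriv_int [MeasurableSpace E] [BorelSpace E] [SecondCountableTopology E] (μ : Measure E)
    [IsFiniteMeasureOnCompacts μ]
    {f : ℝ → E → ℝ} (hf : ContDiff ℝ (⊤ : ℕ∞) (Function.uncurry f))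
    {S K : Set E} (hS : MeasurableSet S) (hK : IsCompact K) (hSK : S ⊆ K) (t : ℝ) :
    HasDerivAt (fun τ => ∫ x in S, f τ x ∂μ) (∫ x in S, deriv (fun s => f s x) t ∂μ) t := by
  have hc := (sm_time hf).continuous
  obtain ⟨C, hC⟩ := ((isCompact_Icc (a := t - 1) (b := t + 1)).prod hK).exists_bound_of_continuousOn
    hc.continuousOn
  have hfin : μ S ≠ ⊤ := ((measure_mono hSK).trans_lt hK.measure_lt_top).ne
  refine (hasDerivAt_integral_of_dominated_loc_of_deriv_le (s := Set.Icc (t - 1) (t + 1))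
    (bound := fun _ => C) (F' := fun τ x => deriv (fun s => f s x) τ)
    (Icc_mem_nhds (by linarith) (by linarith)) ?_ ?_ ?_ ?_ ?_ ?_).2
  · exact Filter.Eventually.of_forall fun τ =>
      (slice_sm hf τ).continuous.aestronglyMeasurable
  · exact ((slice_sm hf t).continuous.continuousOn.integrableOn_compact hK).mono_set hSK
  · exact (slice_sm (sm_time hf) t).continuous.aestronglyMeasurable
  · refine (ae_restrict_iff' hS).2 (Filter.Eventually.of_forall fun x hx τ hτ => ?_)
    exact hC (τ, x) ⟨hτ, hSK hx⟩
  · exact integrableOn_const hfin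
  · exact Filter.Eventually.of_forall fun x τ _ => (sm_diff (slice_sm' hf x) τ).hasDerivAt

end Calc

section TwoD

/-- Iterated integral over the cell. -/
lemma Q_iter (L₁ L₂ : ℝ) (hL₁ : 0 < L₁) (hL₂ : 0 < L₂) {f : ℝ × ℝ → ℝ} (hf : Continuous f) :
    ∫ p in Qcell L₁ L₂, f p
      = ∫ x in (0:ℝ)..(2 * Real.pi * L₁), ∫ y in (0:ℝ)..(2 * Real.pi * L₂), f (x, y) := by
  have hA : 0 ≤ 2 * Real.pi * L₁ := by positivity
  have hB : 0 ≤ 2 * Real.pi * L₂ := by positivity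
  unfold Qcell
  rw [Measure.volume_eq_prod, setIntegral_prod]
  · simp only [intervalIntegral.integral_of_le hA, intervalIntegral.integral_of_le hB,
      integral_Icc_eq_integral_Ioc]
  · exact hf.continuousOn.integrableOn_compact (isCompact_Icc.prod isCompact_Icc)

lemma swap_cont {f : ℝ → ℝ → ℝ} (hf : Continuous (Function.uncurry f)) (a b c d : ℝ) :
    ∫ x in a..b, ∫ y in c..d, f x y = ∫ y in c..d, ∫ x in a..b, f x y := by
  apply intervalIntegral_intervalIntegral_swap
  exact (hf.continuousOn.integrableOn_compact (isCompact_uIcc.prod isCompact_uIcc)).mono_set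
    (Set.prod_mono Set.uIoc_subset_uIcc Set.uIoc_subset_uIcc)

/-- Triple integral abbreviations: integral of an `x₁`-derivative of a periodic function. -/
lemma triple_x {P : ℝ → ℝ → ℝ → ℝ} {P' : ℝ → ℝ → ℝ → ℝ} (A B : ℝ)
    (hP' : Continuous fun z : ℝ × ℝ × ℝ => P' z.1 z.2.1 z.2.2)
    (hd : ∀ x y s, HasDerivAt (fun x => P x y s) (P' x y s) x)
    (hper : ∀ y s, P A y s = P 0 y s) :
    ∫ x in (0:ℝ)..A, ∫ y in (0:ℝ)..B, ∫ s in (0:ℝ)..1, P' x y s = 0 := by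
  rw [swap_cont]
  · have : ∀ y, ∫ x in (0:ℝ)..A, ∫ s in (0:ℝ)..1, P' x y s = 0 := by
      intro y
      rw [swap_cont (by
        exact hP'.comp (by fun_prop : Continuous fun z : ℝ × ℝ => ((z.1, y, z.2) : ℝ × ℝ × ℝ)))]
      have : ∀ s, ∫ x in (0:ℝ)..A, P' x y s = 0 := by
        intro s
        rw [intervalIntegral.integral_eq_sub_of_hasDerivAt (fun x _ => hd x y s)]
        · rw [hper, sub_self]
        · exact (hP'.comp (by fun_prop :
            Continuous fun x : ℝ => ((x, y, s) : ℝ × ℝ × ℝ))).intervalIntegrable _ _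
      simp [this]
    simp [this]
  · exact intervalIntegral.continuous_parametric_intervalIntegral_of_continuous'
      (f := fun (z : ℝ × ℝ) s => P' z.1 z.2 s)
      (hP'.comp (by fun_prop : Continuous fun z : (ℝ × ℝ) × ℝ => ((z.1.1, z.1.2, z.2) : ℝ × ℝ × ℝ)))
      0 1

lemma triple_y {P : ℝ → ℝ → ℝ → ℝ} {P' : ℝ → ℝ → ℝ → ℝ} (A B : ℝ)
    (hP' : Continuous fun z : ℝ × ℝ × ℝ => P' z.1 z.2.1 z.2.2)
    (hd : ∀ x y s, HasDerivAt (fun y => P x y s) (P' x y s) y)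
    (hper : ∀ x s, P x B s = P x 0 s) :
    ∫ x in (0:ℝ)..A, ∫ y in (0:ℝ)..B, ∫ s in (0:ℝ)..1, P' x y s = 0 := by
  have : ∀ x, ∫ y in (0:ℝ)..B, ∫ s in (0:ℝ)..1, P' x y s = 0 := by
    intro x
    rw [swap_cont (by
      exact hP'.comp (by fun_prop : Continuous fun z : ℝ × ℝ => ((x, z.1, z.2) : ℝ × ℝ × ℝ)))]
    have : ∀ s, ∫ y in (0:ℝ)..B, P' x y s = 0 := by
      intro s
      rw [intervalIntegral.integral_eq_sub_of_hasDerivAt (fun y _ => hd x y s)]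
      · rw [hper, sub_self]
      · exact (hP'.comp (by fun_prop :
          Continuous fun y : ℝ => ((x, y, s) : ℝ × ℝ × ℝ))).intervalIntegrable _ _
    simp [this]
  simp [this]

lemma triple_add {f g : ℝ → ℝ → ℝ → ℝ} (A B : ℝ)
    (hf : Continuous fun z : ℝ × ℝ × ℝ => f z.1 z.2.1 z.2.2)
    (hg : Continuous fun z : ℝ × ℝ × ℝ => g z.1 z.2.1 z.2.2) :
    ∫ x in (0:ℝ)..A, ∫ y in (0:ℝ)..B, ∫ s in (0:ℝ)..1, (f x y s + g x y s)
     = (∫ x in (0:ℝ)..A, ∫ y in (0:ℝ)..B, ∫ s in (0:ℝ)..1, f x y s)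
      + ∫ x in (0:ℝ)..A, ∫ y in (0:ℝ)..B, ∫ s in (0:ℝ)..1, g x y s := by
  have c3 : ∀ {f : ℝ → ℝ → ℝ → ℝ}, (Continuous fun z : ℝ × ℝ × ℝ => f z.1 z.2.1 z.2.2) →
      ∀ x y, Continuous (f x y) := fun h x y =>
    h.comp (by fun_prop : Continuous fun s : ℝ => ((x, y, s) : ℝ × ℝ × ℝ))
  have c2 : ∀ {f : ℝ → ℝ → ℝ → ℝ}, (Continuous fun z : ℝ × ℝ × ℝ => f z.1 z.2.1 z.2.2) →
      Continuous fun z : ℝ × ℝ => ∫ s in (0:ℝ)..1, f z.1 z.2 s := fun {f} h =>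
    intervalIntegral.continuous_parametric_intervalIntegral_of_continuous'
      (f := fun (z : ℝ × ℝ) s => f z.1 z.2 s)
      (h.comp (by fun_prop : Continuous fun z : (ℝ × ℝ) × ℝ => ((z.1.1, z.1.2, z.2) : ℝ × ℝ × ℝ)))
      0 1
  have c2' : ∀ {f : ℝ → ℝ → ℝ → ℝ}, (Continuous fun z : ℝ × ℝ × ℝ => f z.1 z.2.1 z.2.2) →
      ∀ x, Continuous fun y : ℝ => ∫ s in (0:ℝ)..1, f x y s := fun h x =>
    (c2 h).comp (by fun_prop : Continuous fun y : ℝ => ((x, y) : ℝ × ℝ))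
  have c1 : ∀ {f : ℝ → ℝ → ℝ → ℝ}, (Continuous fun z : ℝ × ℝ × ℝ => f z.1 z.2.1 z.2.2) →
      Continuous fun x : ℝ => ∫ y in (0:ℝ)..B, ∫ s in (0:ℝ)..1, f x y s := fun {f} h =>
    intervalIntegral.continuous_parametric_intervalIntegral_of_continuous'
      (f := fun x y => ∫ s in (0:ℝ)..1, f x y s) (c2 h) 0 B
  rw [← intervalIntegral.integral_add ((c1 hf).intervalIntegrable _ _)
    ((c1 hg).intervalIntegrable _ _)]
  refine intervalIntegral.integral_congr fun x _ => ?_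
  rw [← intervalIntegral.integral_add ((c2' hf x).intervalIntegrable _ _)
    ((c2' hg x).intervalIntegrable _ _)]
  refine intervalIntegral.integral_congr fun y _ => ?_
  rw [← intervalIntegral.integral_add ((c3 hf x y).intervalIntegrable _ _)
    ((c3 hg x y).intervalIntegrable _ _)]

end TwoD

section Cell

/-- General cell with curved bottom. -/
def gcell (L₁ L₂ : ℝ) (a : ℝ × ℝ → ℝ) (c : ℝ) : Set (Fin 3 → ℝ) :=
  {x | x 0 ∈ Set.Icc 0 (2 * Real.pi * L₁) ∧ x 1 ∈ Set.Icc 0 (2 * Real.pi * L₂) ∧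
    a (x 0, x 1) < x 2 ∧ x 2 < c}

variable {L₁ L₂ : ℝ} {a : ℝ × ℝ → ℝ} {c : ℝ}

lemma gcell_meas (ha : Continuous a) : MeasurableSet (gcell L₁ L₂ a c) := by
  have h0 : Measurable fun x : Fin 3 → ℝ => x 0 := measurable_pi_apply 0
  have h1 : Measurable fun x : Fin 3 → ℝ => x 1 := measurable_pi_apply 1
  have h2 : Measurable fun x : Fin 3 → ℝ => x 2 := measurable_pi_apply 2
  exact (h0 measurableSet_Icc).inter ((h1 measurableSet_Icc).inter
    ((measurableSet_lt (ha.measurable.comp (h0.prodMk h1)) h2).inter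
      (measurableSet_lt h2 measurable_const)))

lemma gcell_sub (ha : Continuous a) : ∃ K, IsCompact K ∧ gcell L₁ L₂ a c ⊆ K := by
  obtain ⟨C, hC⟩ := ((isCompact_Icc (a := 0) (b := 2 * Real.pi * L₁)).prod
    (isCompact_Icc (a := 0) (b := 2 * Real.pi * L₂))).exists_bound_of_continuousOn ha.continuousOn
  refine ⟨Set.Icc ![0, 0, -C] ![2 * Real.pi * L₁, 2 * Real.pi * L₂, c], isCompact_Icc, ?_⟩
  rintro x ⟨h0, h1, h2, h3⟩
  have := (abs_le.1 (hC (x 0, x 1) ⟨h0, h1⟩)).1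
  constructor
  · intro i
    fin_cases i
    · exact h0.1
    · exact h1.1
    · show -C ≤ x 2
      linarith
  · intro i
    fin_cases i
    · exact h0.2
    · exact h1.2
    · exact h3.le

/-- coordinates -/
def e3m : (Fin 3 → ℝ) ≃ᵐ ℝ × (ℝ × ℝ) :=
  (MeasurableEquiv.piFinSuccAbove (fun _ : Fin 3 => ℝ) 2).trans
    (MeasurableEquiv.prodCongr (MeasurableEquiv.refl ℝ) MeasurableEquiv.finTwoArrow)

lemma e3m_mp : MeasurePreserving e3m volume volume := by
  refine MeasurePreserving.trans (volume_preserving_piFinSuccAbove (fun _ : Fin 3 => ℝ) 2) ?_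
  exact (MeasurePreserving.id volume).prod (volume_preserving_finTwoArrow ℝ)

lemma e3m_apply (x : Fin 3 → ℝ) : e3m x = (x 2, (x 0, x 1)) := rfl

lemma e3m_symm (z : ℝ) (p : ℝ × ℝ) : e3m.symm (z, p) = ![p.1, p.2, z] := by
  rw [MeasurableEquiv.symm_apply_eq, e3m_apply]
  rfl

lemma cell_int0 (ha : Continuous a) {f : (Fin 3 → ℝ) → ℝ} (hf : Continuous f) :
    ∫ x in gcell L₁ L₂ a c, f x
      = ∫ p in Qcell L₁ L₂, ∫ z in Set.Ioo (a p) c, f ![p.1, p.2, z] := by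
  obtain ⟨K, hK, hsub⟩ := gcell_sub (L₁ := L₁) (L₂ := L₂) (c := c) ha
  have hint : Integrable ((gcell L₁ L₂ a c).indicator f) :=
    (integrable_indicator_iff (gcell_meas ha)).2
      ((hf.continuousOn.integrableOn_compact hK).mono_set hsub)
  have hsm : MeasurePreserving e3m.symm volume volume := e3m_mp.symm e3m
  have hQ : MeasurableSet (Qcell L₁ L₂) := measurableSet_Icc.prod measurableSet_Icc
  rw [← integral_indicator (gcell_meas ha), ← hsm.integral_comp e3m.symm.measurableEmbedding,
    Measure.volume_eq_prod, integral_prod_symm]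
  · rw [← integral_indicator hQ]
    refine integral_congr_ae (Filter.Eventually.of_forall fun p => ?_)
    simp only [e3m_symm]
    by_cases hp : p ∈ Qcell L₁ L₂
    · rw [Set.indicator_of_mem hp, ← integral_indicator measurableSet_Ioo]
      refine integral_congr_ae (Filter.Eventually.of_forall fun z => ?_)
      by_cases hz : z ∈ Set.Ioo (a p) c
      · rw [Set.indicator_of_mem hz]
        exact Set.indicator_of_mem (show ![p.1, p.2, z] ∈ gcell L₁ L₂ a c from
          ⟨hp.1, hp.2, hz.1, hz.2⟩) f
      · rw [Set.indicator_of_notMem hz]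
        refine Set.indicator_of_notMem (fun h => hz ?_) f
        exact ⟨h.2.2.1, h.2.2.2⟩
    · rw [Set.indicator_of_notMem hp]
      have : ∀ z, (gcell L₁ L₂ a c).indicator f ![p.1, p.2, z] = 0 := fun z =>
        Set.indicator_of_notMem (fun h => hp ⟨h.1, h.2.1⟩) f
      simp [this]
  · rw [← Measure.volume_eq_prod]
    exact (hsm.integrable_comp_emb e3m.symm.measurableEmbedding).2 hint

lemma cell_int (hL₁ : 0 < L₁) (hL₂ : 0 < L₂) (ha : Continuous a) (hac : ∀ p, a p < c)
    {f : (Fin 3 → ℝ) → ℝ} (hf : Continuous f) :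
    ∫ x in gcell L₁ L₂ a c, f x
      = ∫ x in (0:ℝ)..(2 * Real.pi * L₁), ∫ y in (0:ℝ)..(2 * Real.pi * L₂), ∫ s in (0:ℝ)..1,
        (c - a (x, y)) * f ![x, y, a (x, y) + s * (c - a (x, y))] := by
  rw [cell_int0 ha hf]
  have key : ∀ p : ℝ × ℝ, ∫ z in Set.Ioo (a p) c, f ![p.1, p.2, z]
      = ∫ s in (0:ℝ)..1, (c - a p) * f ![p.1, p.2, a p + s * (c - a p)] := by
    intro p
    rw [← integral_Ioc_eq_integral_Ioo, ← intervalIntegral.integral_of_le (hac p).le,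
      intervalIntegral.integral_const_mul]
    have h := intervalIntegral.mul_integral_comp_add_mul (a := 0) (b := 1)
      (f := fun z => f ![p.1, p.2, z]) (c - a p) (a p)
    simp only [mul_zero, add_zero, mul_one, add_sub_cancel] at h
    rw [← h]
    simp only [mul_comm]
  simp only [key]
  have hfc : Continuous fun z : (ℝ × ℝ) × ℝ =>
      (c - a z.1) * f ![z.1.1, z.1.2, a z.1 + z.2 * (c - a z.1)] := by fun_prop
  rw [Q_iter L₁ L₂ hL₁ hL₂
    (f := fun p => ∫ s in (0:ℝ)..1, (c - a p) * f ![p.1, p.2, a p + s * (c - a p)])]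
  exact intervalIntegral.continuous_parametric_intervalIntegral_of_continuous'
      (f := fun (p : ℝ × ℝ) s => (c - a p) * f ![p.1, p.2, a p + s * (c - a p)]) hfc 0 1

lemma fderiv_vec (f : (Fin 3 → ℝ) → ℝ) (x : Fin 3 → ℝ) (u v w : ℝ) :
    fderiv ℝ f x ![u, v, w] = u * pd3 0 f x + v * pd3 1 f x + w * pd3 2 f x := by
  have : (![u, v, w] : Fin 3 → ℝ) = u • (Pi.single 0 1 : Fin 3 → ℝ)
      + v • (Pi.single 1 1 : Fin 3 → ℝ) + w • (Pi.single 2 1 : Fin 3 → ℝ) := by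
    ext i
    fin_cases i <;> simp
  rw [this, map_add, map_add, map_smul, map_smul, map_smul]
  simp [pd3]

lemma curve_deriv {f : (Fin 3 → ℝ) → ℝ} (hf : Differentiable ℝ f) {α β γ : ℝ → ℝ}
    {α' β' γ' r : ℝ} (hα : HasDerivAt α α' r) (hβ : HasDerivAt β β' r) (hγ : HasDerivAt γ γ' r) :
    HasDerivAt (fun r => f ![α r, β r, γ r])
      (α' * pd3 0 f ![α r, β r, γ r] + β' * pd3 1 f ![α r, β r, γ r]
        + γ' * pd3 2 f ![α r, β r, γ r]) r := by
  rw [← fderiv_vec]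
  have h : HasDerivAt (fun r => ![α r, β r, γ r]) ![α', β', γ'] r := by
    rw [hasDerivAt_pi]
    intro i
    fin_cases i
    · exact hα
    · exact hβ
    · exact hγ
  exact (hf _).hasFDerivAt.comp_hasDerivAt r h

lemma pd3_sm {f : (Fin 3 → ℝ) → ℝ} (hf : ContDiff ℝ (⊤ : ℕ∞) f) (i : Fin 3) :
    ContDiff ℝ (⊤ : ℕ∞) (pd3 i f) := sm_dir hf _

lemma hper_vec {f : (Fin 3 → ℝ) → ℝ} (h : HPer3 L₁ L₂ f) :
    (∀ y z, f ![2 * Real.pi * L₁, y, z] = f ![0, y, z]) ∧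
    (∀ x z, f ![x, 2 * Real.pi * L₂, z] = f ![x, 0, z]) := by
  constructor
  · intro y z
    rw [← h.1 ![0, y, z]]
    congr 1
    ext i
    fin_cases i <;> simp
  · intro y z
    rw [← h.2 ![y, 0, z]]
    congr 1
    ext i
    fin_cases i <;> simp

lemma div_thm (hL₁ : 0 < L₁) (hL₂ : 0 < L₂) (ha : ContDiff ℝ (⊤ : ℕ∞) a) (hac : ∀ p, a p < c)
    (haper : HPer2 L₁ L₂ a)
    {F : Fin 3 → (Fin 3 → ℝ) → ℝ} (hF : ∀ i, ContDiff ℝ (⊤ : ℕ∞) (F i))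
    (hper : ∀ i, HPer3 L₁ L₂ (F i)) :
    ∫ x in gcell L₁ L₂ a c, ∑ i : Fin 3, pd3 i (F i) x
      = ∫ p in Qcell L₁ L₂, (F 2 ![p.1, p.2, c]
        - (F 2 ![p.1, p.2, a p] - fderiv ℝ a p (1, 0) * F 0 ![p.1, p.2, a p]
          - fderiv ℝ a p (0, 1) * F 1 ![p.1, p.2, a p])) := by
  have hac' : Continuous a := ha.continuous
  set a1 : ℝ × ℝ → ℝ := fun p => fderiv ℝ a p (1, 0) with ha1
  set a2 : ℝ × ℝ → ℝ := fun p => fderiv ℝ a p (0, 1) with ha2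
  have ca1 : Continuous a1 := (sm_dir ha _).continuous
  have ca2 : Continuous a2 := (sm_dir ha _).continuous
  have cF : ∀ i, Continuous (F i) := fun i => (hF i).continuous
  have cdF : ∀ i j, Continuous (pd3 j (F i)) := fun i j => (pd3_sm (hF i) j).continuous
  have dF : ∀ i, Differentiable ℝ (F i) := fun i => sm_diff (hF i)
  have hdx : ∀ x y, HasDerivAt (fun x => a (x, y)) (a1 (x, y)) x := by
    intro x y
    have h : HasDerivAt (fun x : ℝ => ((x, y) : ℝ × ℝ)) (1, 0) x :=
      (hasDerivAt_id x).prodMk (hasDerivAt_const x y)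
    exact (sm_diff ha (x, y)).hasFDerivAt.comp_hasDerivAt x h
  have hdy : ∀ x y, HasDerivAt (fun y => a (x, y)) (a2 (x, y)) y := by
    intro x y
    have h : HasDerivAt (fun y : ℝ => ((x, y) : ℝ × ℝ)) (0, 1) y :=
      (hasDerivAt_const y x).prodMk (hasDerivAt_id y)
    exact (sm_diff ha (x, y)).hasFDerivAt.comp_hasDerivAt y h
  have crhs : Continuous fun p : ℝ × ℝ => (F 2 ![p.1, p.2, c]
        - (F 2 ![p.1, p.2, a p] - a1 p * F 0 ![p.1, p.2, a p]
          - a2 p * F 1 ![p.1, p.2, a p])) := by fun_prop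
  rw [cell_int hL₁ hL₂ hac' hac (by fun_prop), Q_iter L₁ L₂ hL₁ hL₂ crhs]
  -- the flattening map
  set Φ : ℝ → ℝ → ℝ → (Fin 3 → ℝ) := fun x y s => ![x, y, a (x, y) + s * (c - a (x, y))] with hΦ
  have cΦ : Continuous fun z : ℝ × ℝ × ℝ => Φ z.1 z.2.1 z.2.2 := by
    simp only [hΦ]
    fun_prop
  set P' : ℝ → ℝ → ℝ → ℝ := fun x y s =>
    (-a1 (x, y)) * F 0 (Φ x y s) + (c - a (x, y)) *
      (1 * pd3 0 (F 0) (Φ x y s) + 0 * pd3 1 (F 0) (Φ x y s)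
        + (a1 (x, y) + s * (-a1 (x, y))) * pd3 2 (F 0) (Φ x y s)) with hP'
  set R' : ℝ → ℝ → ℝ → ℝ := fun x y s =>
    (-a2 (x, y)) * F 1 (Φ x y s) + (c - a (x, y)) *
      (0 * pd3 0 (F 1) (Φ x y s) + 1 * pd3 1 (F 1) (Φ x y s)
        + (a2 (x, y) + s * (-a2 (x, y))) * pd3 2 (F 1) (Φ x y s)) with hR'
  set S' : ℝ → ℝ → ℝ → ℝ := fun x y s =>
    (c - a (x, y)) * pd3 2 (F 2) (Φ x y s)
      - (-a1 (x, y) * F 0 (Φ x y s)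
          + ((1 - s) * a1 (x, y)) * ((c - a (x, y)) * pd3 2 (F 0) (Φ x y s)))
      - (-a2 (x, y) * F 1 (Φ x y s)
          + ((1 - s) * a2 (x, y)) * ((c - a (x, y)) * pd3 2 (F 1) (Φ x y s))) with hS'
  have cP' : Continuous fun z : ℝ × ℝ × ℝ => P' z.1 z.2.1 z.2.2 := by
    simp only [hP']
    fun_prop
  have cR' : Continuous fun z : ℝ × ℝ × ℝ => R' z.1 z.2.1 z.2.2 := by
    simp only [hR']
    fun_prop
  have cS' : Continuous fun z : ℝ × ℝ × ℝ => S' z.1 z.2.1 z.2.2 := by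
    simp only [hS']
    fun_prop
  have hpt : ∀ x y s, (c - a (x, y)) * ∑ i : Fin 3, pd3 i (F i)
      ![x, y, a (x, y) + s * (c - a (x, y))] = (P' x y s + R' x y s) + S' x y s := by
    intro x y s
    simp only [hP', hR', hS', hΦ, Fin.sum_univ_three]
    ring
  have hPz : ∫ x in (0:ℝ)..(2 * Real.pi * L₁), ∫ y in (0:ℝ)..(2 * Real.pi * L₂),
      ∫ s in (0:ℝ)..1, P' x y s = 0 := by
    refine triple_x (P := fun x y s => (c - a (x, y)) * F 0 (Φ x y s)) _ _ cP' ?_ ?_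
    · intro x y s
      have h1 : HasDerivAt (fun x => c - a (x, y)) (-a1 (x, y)) x := (hdx x y).const_sub c
      exact h1.mul (curve_deriv (dF 0) (hasDerivAt_id x) (hasDerivAt_const x y)
        ((hdx x y).add (h1.const_mul s)))
    · intro y s
      have := haper.1 (0, y)
      simp only [zero_add] at this
      simp only [hΦ, this, (hper_vec (hper 0)).1]
  have hRz : ∫ x in (0:ℝ)..(2 * Real.pi * L₁), ∫ y in (0:ℝ)..(2 * Real.pi * L₂),
      ∫ s in (0:ℝ)..1, R' x y s = 0 := by
    refine triple_y (P := fun x y s => (c - a (x, y)) * F 1 (Φ x y s)) _ _ cR' ?_ ?_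
    · intro x y s
      have h1 : HasDerivAt (fun y => c - a (x, y)) (-a2 (x, y)) y := (hdy x y).const_sub c
      exact h1.mul (curve_deriv (dF 1) (hasDerivAt_const y x) (hasDerivAt_id y)
        ((hdy x y).add (h1.const_mul s)))
    · intro x s
      have := haper.2 (x, 0)
      simp only [zero_add] at this
      simp only [hΦ, this, (hper_vec (hper 1)).2]
  simp only [hpt]
  rw [triple_add (f := fun x y s => P' x y s + R' x y s) _ _ (cP'.add cR') cS',
    triple_add _ _ cP' cR', hPz, hRz, add_zero, zero_add]
  refine intervalIntegral.integral_congr fun x _ => intervalIntegral.integral_congr fun y _ => ?_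
  have hd : ∀ s ∈ Set.uIcc (0:ℝ) 1, HasDerivAt (fun s => F 2 (Φ x y s)
      - ((1 - s) * a1 (x, y)) * F 0 (Φ x y s) - ((1 - s) * a2 (x, y)) * F 1 (Φ x y s))
      (S' x y s) s := by
    intro s _
    have hc : ∀ i, HasDerivAt (fun s => F i (Φ x y s)) _ s := fun i =>
      curve_deriv (dF i) (hasDerivAt_const s x) (hasDerivAt_const s y)
        (((hasDerivAt_id s).mul_const (c - a (x, y))).const_add (a (x, y)))
    have hl : ∀ k : ℝ, HasDerivAt (fun s : ℝ => (1 - s) * k) (-1 * k) s := fun k =>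
      ((hasDerivAt_id s).const_sub 1).mul_const k
    have := ((hc 2).sub ((hl (a1 (x, y))).mul (hc 0))).sub ((hl (a2 (x, y))).mul (hc 1))
    refine this.congr_deriv ?_
    simp only [hS', hΦ]
    ring
  rw [intervalIntegral.integral_eq_sub_of_hasDerivAt hd
    ((cS'.comp (by fun_prop : Continuous fun s : ℝ => ((x, y, s) : ℝ × ℝ × ℝ))).intervalIntegrable
      _ _)]
  simp [hΦ]

end Cell

section Surf

variable {L₁ L₂ : ℝ}

lemma fderiv_shift {E : Type*} [NormedAddCommGroup E] [NormedSpace ℝ E] {f : E → ℝ} {v : E}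
    (h : ∀ x, f (x + v) = f x) (x w : E) : fderiv ℝ f (x + v) w = fderiv ℝ f x w := by
  have : (fun y => f (y + v)) = f := funext h
  rw [← fderiv_comp_add_right, this]

lemma hper2_iff {f : ℝ × ℝ → ℝ} : HPer2 L₁ L₂ f ↔
    (∀ p, f (p + (2 * Real.pi * L₁, 0)) = f p) ∧ (∀ p, f (p + (0, 2 * Real.pi * L₂)) = f p) := by
  unfold HPer2
  refine and_congr (forall_congr' fun p => ?_) (forall_congr' fun p => ?_)
  · rw [show p + (2 * Real.pi * L₁, 0) = (p.1 + 2 * Real.pi * L₁, p.2) from by ext <;> simp]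
  · rw [show p + (0, 2 * Real.pi * L₂) = (p.1, p.2 + 2 * Real.pi * L₂) from by ext <;> simp]

lemma hper2_dir {f : ℝ × ℝ → ℝ} (h : HPer2 L₁ L₂ f) (w : ℝ × ℝ) :
    HPer2 L₁ L₂ (fun p => fderiv ℝ f p w) := by
  rw [hper2_iff] at *
  exact ⟨fun p => fderiv_shift h.1 p w, fun p => fderiv_shift h.2 p w⟩

lemma hper3_pd {f : (Fin 3 → ℝ) → ℝ} (h : HPer3 L₁ L₂ f) (i : Fin 3) :
    HPer3 L₁ L₂ (pd3 i f) :=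
  ⟨fun p => fderiv_shift h.1 p _, fun p => fderiv_shift h.2 p _⟩

lemma two_div (hL₁ : 0 < L₁) (hL₂ : 0 < L₂) {h k : ℝ × ℝ → ℝ} (hh : ContDiff ℝ (⊤ : ℕ∞) h)
    (hk : ContDiff ℝ (⊤ : ℕ∞) k) (ph : HPer2 L₁ L₂ h) (pk : HPer2 L₁ L₂ k) :
    ∫ p in Qcell L₁ L₂, (fderiv ℝ h p (1, 0) + fderiv ℝ k p (0, 1)) = 0 := by
  have c1 : Continuous fun p => fderiv ℝ h p (1, 0) := (sm_dir hh _).continuous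
  have c2 : Continuous fun p => fderiv ℝ k p (0, 1) := (sm_dir hk _).continuous
  rw [Q_iter L₁ L₂ hL₁ hL₂ (f := fun p => fderiv ℝ h p (1, 0) + fderiv ℝ k p (0, 1))
    (c1.add c2)]
  have e : (∫ x in (0:ℝ)..(2 * Real.pi * L₁), ∫ y in (0:ℝ)..(2 * Real.pi * L₂),
        (fderiv ℝ h (x, y) (1, 0) + fderiv ℝ k (x, y) (0, 1)))
      = ∫ x in (0:ℝ)..(2 * Real.pi * L₁), ∫ y in (0:ℝ)..(2 * Real.pi * L₂), ∫ _s in (0:ℝ)..1,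
        (fderiv ℝ h (x, y) (1, 0) + fderiv ℝ k (x, y) (0, 1)) := by
    simp only [intervalIntegral.integral_const, sub_zero, one_smul]
  have cc : Continuous fun z : ℝ × ℝ × ℝ => ((z.1, z.2.1) : ℝ × ℝ) := by fun_prop
  rw [e]
  rw [triple_add (f := fun x y _ => fderiv ℝ h (x, y) (1, 0))
    (g := fun x y _ => fderiv ℝ k (x, y) (0, 1)) _ _ (c1.comp cc) (c2.comp cc)]
  rw [triple_x (P := fun x y _ => h (x, y)) _ _ (c1.comp cc),
    triple_y (P := fun x y _ => k (x, y)) _ _ (c2.comp cc), add_zero]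
  · intro x y _
    have h : HasDerivAt (fun y : ℝ => ((x, y) : ℝ × ℝ)) (0, 1) y :=
      (hasDerivAt_const y x).prodMk (hasDerivAt_id y)
    exact (sm_diff hk (x, y)).hasFDerivAt.comp_hasDerivAt y h
  · intro x _
    simpa using pk.2 (x, 0)
  · intro x y _
    have h : HasDerivAt (fun x : ℝ => ((x, y) : ℝ × ℝ)) (1, 0) x :=
      (hasDerivAt_id x).prodMk (hasDerivAt_const x y)
    exact (sm_diff hh (x, y)).hasFDerivAt.comp_hasDerivAt x h
  · intro y _
    simpa using ph.1 (0, y)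

lemma Q_compact : IsCompact (Qcell L₁ L₂) := isCompact_Icc.prod isCompact_Icc

lemma Q_intble {f : ℝ × ℝ → ℝ} (hf : Continuous f) : IntegrableOn f (Qcell L₁ L₂) :=
  hf.continuousOn.integrableOn_compact Q_compact

lemma Q_add4 {f g h k : ℝ × ℝ → ℝ} (hf : Continuous f) (hg : Continuous g) (hh : Continuous h)
    (hk : Continuous k) (hz : ∀ p, f p + g p + h p + k p = 0) :
    (∫ p in Qcell L₁ L₂, f p) + (∫ p in Qcell L₁ L₂, g p) + (∫ p in Qcell L₁ L₂, h p)
      + (∫ p in Qcell L₁ L₂, k p) = 0 := by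
  have e1 := integral_add (Q_intble (L₁ := L₁) (L₂ := L₂) hf) (Q_intble hg)
  have e2 := integral_add (Q_intble (L₁ := L₁) (L₂ := L₂) (hf.add hg)) (Q_intble hh)
  have e3 := integral_add (Q_intble (L₁ := L₁) (L₂ := L₂) ((hf.add hg).add hh)) (Q_intble hk)
  simp only [Pi.add_apply, hz, integral_zero] at e1 e2 e3
  linarith

lemma lap2_cont {f : ℝ × ℝ → ℝ} (hf : ContDiff ℝ (⊤ : ℕ∞) f) : Continuous (lap2 f) :=
  ((sm_dir (sm_dir hf _) _).add (sm_dir (sm_dir hf _) _)).continuous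

lemma surf (hL₁ : 0 < L₁) (hL₂ : 0 < L₂) {ζ : ℝ → ℝ × ℝ → ℝ}
    (hζ : ContDiff ℝ (⊤ : ℕ∞) (Function.uncurry ζ)) (hper : ∀ t, HPer2 L₁ L₂ (ζ t))
    (α σ t : ℝ) :
    HasDerivAt (fun τ => (1 / 2) * ∫ p in Qcell L₁ L₂, (α * (ζ τ p) ^ 2
        + σ * ((fderiv ℝ (ζ τ) p (1, 0)) ^ 2 + (fderiv ℝ (ζ τ) p (0, 1)) ^ 2)))
      (∫ p in Qcell L₁ L₂, (α * ζ t p - σ * lap2 (ζ t) p) * deriv (fun s => ζ s p) t) t := by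
  have h1 := sm_space hζ (1, 0)
  have h2 := sm_space hζ (0, 1)
  have hf : ContDiff ℝ (⊤ : ℕ∞) (Function.uncurry fun τ p => α * (ζ τ p) ^ 2
        + σ * ((fderiv ℝ (ζ τ) p (1, 0)) ^ 2 + (fderiv ℝ (ζ τ) p (0, 1)) ^ 2)) :=
    (contDiff_const.mul (hζ.pow 2)).add (contDiff_const.mul ((h1.pow 2).add (h2.pow 2)))
  have key := (deriv_int volume hf (Q_compact (L₁ := L₁) (L₂ := L₂)).measurableSet
    Q_compact subset_rfl t).const_mul (1 / 2)
  refine key.congr_deriv ?_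
  have sζ := slice_sm hζ t
  have sT := slice_sm (sm_time hζ) t
  set T : ℝ × ℝ → ℝ := fun p => deriv (fun s => ζ s p) t with hT
  have sT : ContDiff ℝ (⊤ : ℕ∞) T := sT
  have pT : HPer2 L₁ L₂ T := by
    constructor
    · intro p
      simp only [hT, (hper _).1 p]
    · intro p
      simp only [hT, (hper _).2 p]
  have s1 := sm_dir sζ (1, 0)
  have s2 := sm_dir sζ (0, 1)
  have hz := two_div hL₁ hL₂ (s1.mul sT) (s2.mul sT)
    ⟨fun p => by simp only [(hper2_dir (hper t) (1, 0)).1 p, pT.1 p],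
      fun p => by simp only [(hper2_dir (hper t) (1, 0)).2 p, pT.2 p]⟩
    ⟨fun p => by simp only [(hper2_dir (hper t) (0, 1)).1 p, pT.1 p],
      fun p => by simp only [(hper2_dir (hper t) (0, 1)).2 p, pT.2 p]⟩
  have cz : Continuous fun p => fderiv ℝ (fun y => fderiv ℝ (ζ t) y (1, 0) * T y) p (1, 0)
      + fderiv ℝ (fun y => fderiv ℝ (ζ t) y (0, 1) * T y) p (0, 1) :=
    ((sm_dir (s1.mul sT) _).add (sm_dir (s2.mul sT) _)).continuous
  have cm : Continuous fun p => (α * ζ t p - σ * lap2 (ζ t) p) * T p :=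
    ((sζ.continuous.const_mul _).sub ((lap2_cont sζ).const_mul _)).mul sT.continuous
  have hpt : ∀ p, (1 / 2) * deriv (fun s => α * (ζ s p) ^ 2
        + σ * ((fderiv ℝ (ζ s) p (1, 0)) ^ 2 + (fderiv ℝ (ζ s) p (0, 1)) ^ 2)) t
      = (α * ζ t p - σ * lap2 (ζ t) p) * T p
        + σ * (fderiv ℝ (fun y => fderiv ℝ (ζ t) y (1, 0) * T y) p (1, 0)
          + fderiv ℝ (fun y => fderiv ℝ (ζ t) y (0, 1) * T y) p (0, 1)) := by
    intro p
    have d0 := (sm_diff (slice_sm' hζ p) t).hasDerivAt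
    have d1 := (sm_diff (slice_sm' h1 p) t).hasDerivAt
    have d2 := (sm_diff (slice_sm' h2 p) t).hasDerivAt
    rw [time_space hζ] at d1 d2
    have D := ((d0.pow 2).const_mul α).add (((d1.pow 2).add (d2.pow 2)).const_mul σ)
    have D' := D.deriv
    simp only [Pi.add_def, Pi.pow_def] at D'
    erw [D']
    rw [fderiv_fun_mul (sm_diff s1 p) (sm_diff sT p), fderiv_fun_mul (sm_diff s2 p) (sm_diff sT p)]
    simp only [lap2, add_apply, smul_apply, smul_eq_mul]
    simp only [hT]
    push_cast
    ring
  rw [← integral_const_mul]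
  simp only [hpt]
  rw [integral_add (Q_intble cm) ((Q_intble cz).const_mul σ), integral_const_mul]
  have hz' : ∫ p in Qcell L₁ L₂, (fderiv ℝ (fun y => fderiv ℝ (ζ t) y (1, 0) * T y) p (1, 0)
          + fderiv ℝ (fun y => fderiv ℝ (ζ t) y (0, 1) * T y) p (0, 1)) = 0 := hz
  rw [hz', mul_zero, add_zero]

end Surf

section Phase

variable {L₁ L₂ : ℝ} {a : ℝ × ℝ → ℝ} {c : ℝ}

/-- Energy flux. -/
noncomputable def flux (μ : ℝ) (u : (Fin 3 → ℝ) → (Fin 3 → ℝ)) (q : (Fin 3 → ℝ) → ℝ) (i : Fin 3)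
    (x : Fin 3 → ℝ) : ℝ :=
  (∑ j : Fin 3, u x j * (μ * (pd3 i (fun z => u z j) x + pd3 j (fun z => u z i) x)))
    - q x * u x i

lemma pd3_mul {f g : (Fin 3 → ℝ) → ℝ} {x : Fin 3 → ℝ} (i : Fin 3) (hf : DifferentiableAt ℝ f x)
    (hg : DifferentiableAt ℝ g x) :
    pd3 i (fun y => f y * g y) x = f x * pd3 i g x + g x * pd3 i f x := by
  simp [pd3, fderiv_fun_mul hf hg]

lemma pd3_add {f g : (Fin 3 → ℝ) → ℝ} {x : Fin 3 → ℝ} (i : Fin 3) (hf : DifferentiableAt ℝ f x)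
    (hg : DifferentiableAt ℝ g x) :
    pd3 i (fun y => f y + g y) x = pd3 i f x + pd3 i g x := by
  simp [pd3, fderiv_fun_add hf hg]

lemma pd3_sub {f g : (Fin 3 → ℝ) → ℝ} {x : Fin 3 → ℝ} (i : Fin 3) (hf : DifferentiableAt ℝ f x)
    (hg : DifferentiableAt ℝ g x) :
    pd3 i (fun y => f y - g y) x = pd3 i f x - pd3 i g x := by
  simp [pd3, fderiv_fun_sub hf hg]

lemma pd3_cmul {f : (Fin 3 → ℝ) → ℝ} {x : Fin 3 → ℝ} (i : Fin 3) (k : ℝ)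
    (hf : DifferentiableAt ℝ f x) :
    pd3 i (fun y => k * f y) x = k * pd3 i f x := by
  simp [pd3, fderiv_const_mul hf]

lemma pd3_sum {f : Fin 3 → (Fin 3 → ℝ) → ℝ} {x : Fin 3 → ℝ} (i : Fin 3)
    (hf : ∀ j, DifferentiableAt ℝ (f j) x) :
    pd3 i (fun y => ∑ j, f j y) x = ∑ j, pd3 i (f j) x := by
  simp [pd3, fderiv_fun_sum fun j _ => hf j]

lemma comp_sm {E : Type*} [NormedAddCommGroup E] [NormedSpace ℝ E] {u : E → (Fin 3 → ℝ)}
    (hu : ContDiff ℝ (⊤ : ℕ∞) u) (j : Fin 3) : ContDiff ℝ (⊤ : ℕ∞) fun z => u z j :=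
  contDiff_pi.1 hu j

lemma flux_sm {μ : ℝ} {u : (Fin 3 → ℝ) → (Fin 3 → ℝ)} {q : (Fin 3 → ℝ) → ℝ}
    (hu : ContDiff ℝ (⊤ : ℕ∞) u) (hq : ContDiff ℝ (⊤ : ℕ∞) q) (i : Fin 3) :
    ContDiff ℝ (⊤ : ℕ∞) (flux μ u q i) := by
  unfold flux
  refine ContDiff.sub (ContDiff.sum fun j _ => ?_) (hq.mul (comp_sm hu i))
  exact (comp_sm hu j).mul (contDiff_const.mul
    ((pd3_sm (comp_sm hu j) i).add (pd3_sm (comp_sm hu i) j)))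

lemma flux_per {μ : ℝ} {u : (Fin 3 → ℝ) → (Fin 3 → ℝ)} {q : (Fin 3 → ℝ) → ℝ}
    (hu : HPer3 L₁ L₂ u) (hq : HPer3 L₁ L₂ q) (i : Fin 3) :
    HPer3 L₁ L₂ (flux μ u q i) := by
  have hc : ∀ j, HPer3 L₁ L₂ (fun z => u z j) := fun j =>
    ⟨fun x => congrFun (hu.1 x) j, fun x => congrFun (hu.2 x) j⟩
  constructor
  · intro x
    simp only [flux, hu.1 x, hq.1 x, fun i j => (hper3_pd (hc j) i).1 x]
  · intro x
    simp only [flux, hu.2 x, hq.2 x, fun i j => (hper3_pd (hc j) i).2 x]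

lemma flux_div {μ : ℝ} {u : (Fin 3 → ℝ) → (Fin 3 → ℝ)} {q : (Fin 3 → ℝ) → ℝ}
    (hu : ContDiff ℝ (⊤ : ℕ∞) u) (hq : ContDiff ℝ (⊤ : ℕ∞) q) (x : Fin 3 → ℝ)
    (hdiv : ∀ᶠ y in nhds x, (∑ i : Fin 3, pd3 i (fun z => u z i) y) = 0) (T : Fin 3 → ℝ)
    (hmom : ∀ j, T j - μ * (∑ i : Fin 3, pd3 i (pd3 i (fun z => u z j)) x) + pd3 j q x = 0) :
    ∑ i : Fin 3, pd3 i (flux μ u q i) x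
      = (∑ j, u x j * T j) + (1 / 2) * (μ * ∑ i : Fin 3, ∑ j : Fin 3,
        (pd3 i (fun z => u z j) x + pd3 j (fun z => u z i) x) ^ 2) := by
  have du : ∀ j, DifferentiableAt ℝ (fun z => u z j) x := fun j => sm_diff (comp_sm hu j) x
  have ddu : ∀ i j, DifferentiableAt ℝ (pd3 i (fun z => u z j)) x := fun i j =>
    sm_diff (pd3_sm (comp_sm hu j) i) x
  have dq : DifferentiableAt ℝ q x := sm_diff hq x
  have h0 : (∑ i : Fin 3, pd3 i (fun z => u z i) x) = 0 := hdiv.self_of_nhds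
  have h1 : ∀ j, ∑ i : Fin 3, pd3 i (pd3 j (fun z => u z i)) x = 0 := by
    intro j
    have e1 : pd3 j (fun y => ∑ i : Fin 3, pd3 i (fun z => u z i) y) x = 0 := by
      unfold pd3 at hdiv ⊢
      rw [Filter.EventuallyEq.fderiv_eq (f := fun _ => (0 : ℝ)) hdiv]
      simp
    rw [pd3_sum j (fun i => ddu i i)] at e1
    rw [← e1]
    exact Finset.sum_congr rfl fun i _ => sm_symm (comp_sm hu i) _ _ x
  have hF : ∀ i, pd3 i (flux μ u q i) x
      = (∑ j, (u x j * (μ * (pd3 i (pd3 i (fun z => u z j)) x + pd3 i (pd3 j (fun z => u z i)) x))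
        + (μ * (pd3 i (fun z => u z j) x + pd3 j (fun z => u z i) x)) * pd3 i (fun z => u z j) x))
        - (q x * pd3 i (fun z => u z i) x + u x i * pd3 i q x) := by
    intro i
    have dsum : ∀ j, DifferentiableAt ℝ
        (fun y => pd3 i (fun z => u z j) y + pd3 j (fun z => u z i) y) x := fun j =>
      (ddu i j).add (ddu j i)
    have dterm : ∀ j, DifferentiableAt ℝ
        (fun y => u y j * (μ * (pd3 i (fun z => u z j) y + pd3 j (fun z => u z i) y))) x :=
      fun j => (du j).mul ((dsum j).const_mul μ)
    have dS : DifferentiableAt ℝ (fun y => ∑ j : Fin 3,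
        u y j * (μ * (pd3 i (fun z => u z j) y + pd3 j (fun z => u z i) y))) x :=
      DifferentiableAt.fun_sum fun j _ => dterm j
    have dQ : DifferentiableAt ℝ (fun y => q y * u y i) x := dq.mul (du i)
    unfold flux
    rw [pd3_sub i dS dQ,
      pd3_sum i dterm, pd3_mul i dq (du i)]
    congr 1
    refine Finset.sum_congr rfl fun j _ => ?_
    rw [pd3_mul i (du j) ((dsum j).const_mul μ), pd3_cmul i μ (dsum j),
      pd3_add i (ddu i j) (ddu j i)]
  simp only [hF]
  have m0 := hmom 0
  have m1 := hmom 1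
  have m2 := hmom 2
  have k0 := h1 0
  have k1 := h1 1
  have k2 := h1 2
  simp only [Fin.sum_univ_three] at *
  linear_combination (-u x 0) * m0 - u x 1 * m1 - u x 2 * m2 + μ * u x 0 * k0 + μ * u x 1 * k1
    + μ * u x 2 * k2 - q x * h0

lemma phase (hL₁ : 0 < L₁) (hL₂ : 0 < L₂) (ha : ContDiff ℝ (⊤ : ℕ∞) a) (hac : ∀ p, a p < c)
    (haper : HPer2 L₁ L₂ a) (ρ μ : ℝ) {v : ℝ → (Fin 3 → ℝ) → (Fin 3 → ℝ)}
    {q : ℝ → (Fin 3 → ℝ) → ℝ}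
    (hv : ContDiff ℝ (⊤ : ℕ∞) (Function.uncurry v))
    (hq : ContDiff ℝ (⊤ : ℕ∞) (Function.uncurry q))
    (hvper : ∀ t, HPer3 L₁ L₂ (v t)) (hqper : ∀ t, HPer3 L₁ L₂ (q t))
    (hmom : ∀ t : ℝ, ∀ x : Fin 3 → ℝ, a (x 0, x 1) ≤ x 2 → x 2 ≤ c → ∀ j : Fin 3,
      ρ * deriv (fun s => v s x j) t
          - μ * (∑ i : Fin 3, pd3 i (pd3 i (fun z => v t z j)) x)
          + pd3 j (q t) x = 0)
    (hdiv : ∀ t : ℝ, ∀ x : Fin 3 → ℝ, a (x 0, x 1) ≤ x 2 → x 2 ≤ c →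
      (∑ i : Fin 3, pd3 i (fun z => v t z i) x) = 0) (t : ℝ) :
    HasDerivAt (fun τ : ℝ =>
          (1 / 2) * (∫ x in gcell L₁ L₂ a c, ρ * ∑ j : Fin 3, (v τ x j) ^ 2))
      ((∫ p in Qcell L₁ L₂, (flux μ (v t) (q t) 2 ![p.1, p.2, c]
        - (flux μ (v t) (q t) 2 ![p.1, p.2, a p]
          - fderiv ℝ a p (1, 0) * flux μ (v t) (q t) 0 ![p.1, p.2, a p]
          - fderiv ℝ a p (0, 1) * flux μ (v t) (q t) 1 ![p.1, p.2, a p])))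
        - (1 / 2) * (∫ x in gcell L₁ L₂ a c, μ * ∑ i : Fin 3, ∑ j : Fin 3,
              (pd3 i (fun z => v t z j) x + pd3 j (fun z => v t z i) x) ^ 2)) t := by
  have hvj : ∀ j, ContDiff ℝ (⊤ : ℕ∞) (Function.uncurry fun τ x => v τ x j) := fun j =>
    comp_sm hv j
  have hf : ContDiff ℝ (⊤ : ℕ∞) (Function.uncurry fun τ x => ρ * ∑ j : Fin 3, (v τ x j) ^ 2) :=
    contDiff_const.mul (ContDiff.sum fun j _ => (hvj j).pow 2)
  obtain ⟨K, hK, hsub⟩ := gcell_sub (L₁ := L₁) (L₂ := L₂) (c := c) ha.continuous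
  have hmeas := gcell_meas (L₁ := L₁) (L₂ := L₂) (c := c) ha.continuous
  have key := (deriv_int volume hf hmeas hK hsub t).const_mul (1 / 2)
  refine key.congr_deriv ?_
  have sv := slice_sm hv t
  have sq := slice_sm hq t
  rw [← div_thm hL₁ hL₂ ha hac haper (fun i => flux_sm sv sq i)
    (fun i => flux_per (hvper t) (hqper t) i)]
  have ib : ∀ {f : (Fin 3 → ℝ) → ℝ}, Continuous f → IntegrableOn f (gcell L₁ L₂ a c) :=
    fun h => (h.continuousOn.integrableOn_compact hK).mono_set hsub
  have c1 : Continuous fun x => ∑ i : Fin 3, pd3 i (flux μ (v t) (q t) i) x :=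
    continuous_finsetSum _ fun i _ => (pd3_sm (flux_sm sv sq i) i).continuous
  have c2 : Continuous fun x => μ * ∑ i : Fin 3, ∑ j : Fin 3,
      (pd3 i (fun z => v t z j) x + pd3 j (fun z => v t z i) x) ^ 2 := by
    refine continuous_const.mul (continuous_finsetSum _ fun i _ => continuous_finsetSum _
      fun j _ => ?_)
    exact ((pd3_sm (comp_sm sv j) i).continuous.add (pd3_sm (comp_sm sv i) j).continuous).pow 2
  rw [← integral_const_mul, ← integral_const_mul, ← integral_sub (ib c1) ((ib c2).const_mul _)]
  refine setIntegral_congr_fun hmeas fun x hx => ?_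
  have hx2 : a (x 0, x 1) < x 2 := hx.2.2.1
  have hx3 : x 2 < c := hx.2.2.2
  have hev : ∀ᶠ y in nhds x, (∑ i : Fin 3, pd3 i (fun z => v t z i) y) = 0 := by
    have ca : Continuous fun y : Fin 3 → ℝ => a (y 0, y 1) :=
      ha.continuous.comp ((continuous_apply 0).prodMk (continuous_apply 1))
    have cy : Continuous fun y : Fin 3 → ℝ => y 2 := continuous_apply 2
    filter_upwards [ca.continuousAt.eventually_lt cy.continuousAt hx2,
      cy.continuousAt.eventually_lt continuousAt_const hx3] with y h1 h2
    exact hdiv t y h1.le h2.le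
  have e := flux_div (μ := μ) sv sq x hev (fun j => ρ * deriv (fun s => v s x j) t)
    (hmom t x hx2.le hx3.le)
  rw [e]
  have d : ∀ j, HasDerivAt (fun s => v s x j) (deriv (fun s => v s x j) t) t := fun j =>
    (sm_diff (slice_sm' (hvj j) x) t).hasDerivAt
  have D : HasDerivAt (fun s => ρ * ∑ j : Fin 3, (v s x j) ^ 2) _ t :=
    (HasDerivAt.fun_sum (u := Finset.univ) fun j _ => (d j).fun_pow 2).const_mul ρ
  rw [D.deriv]
  simp only [Fin.sum_univ_three]
  push_cast
  ring

end Phase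

/-- Energy identity for the homogeneous linearized two-phase problem with surface
tension: the natural energy (including the surface-tension terms) is differentiable in
time and its derivative equals minus the viscous dissipation. -/
theorem stmt_12
    (L₁ L₂ : ℝ) (hL₁ : 0 < L₁) (hL₂ : 0 < L₂)
    (b : ℝ × ℝ → ℝ) (hb : ContDiff ℝ (⊤ : ℕ∞) b) (hbpos : ∀ p : ℝ × ℝ, 0 < b p)
    (hbper : HPer2 L₁ L₂ b)
    (ρp ρm μp μm g σp σm : ℝ) (hρp : 0 < ρp) (hρm : 0 < ρm) (hμp : 0 < μp) (hμm : 0 < μm)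
    (hg : 0 < g) (hσp : 0 < σp) (hσm : 0 < σm)
    (vp vm : ℝ → (Fin 3 → ℝ) → (Fin 3 → ℝ))
    (qp qm : ℝ → (Fin 3 → ℝ) → ℝ)
    (ζp ζm : ℝ → ℝ × ℝ → ℝ)
    (hvps : ContDiff ℝ (⊤ : ℕ∞) (Function.uncurry vp))
    (hvms : ContDiff ℝ (⊤ : ℕ∞) (Function.uncurry vm))
    (hqps : ContDiff ℝ (⊤ : ℕ∞) (Function.uncurry qp))
    (hqms : ContDiff ℝ (⊤ : ℕ∞) (Function.uncurry qm))
    (hζps : ContDiff ℝ (⊤ : ℕ∞) (Function.uncurry ζp))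
    (hζms : ContDiff ℝ (⊤ : ℕ∞) (Function.uncurry ζm))
    (hvpper : ∀ t, HPer3 L₁ L₂ (vp t)) (hvmper : ∀ t, HPer3 L₁ L₂ (vm t))
    (hqpper : ∀ t, HPer3 L₁ L₂ (qp t)) (hqmper : ∀ t, HPer3 L₁ L₂ (qm t))
    (hζpper : ∀ t, HPer2 L₁ L₂ (ζp t)) (hζmper : ∀ t, HPer2 L₁ L₂ (ζm t))
    -- homogeneous momentum equations on the closures of Ω₊ and Ω₋
    (hmomp : ∀ t : ℝ, ∀ x : Fin 3 → ℝ, 0 ≤ x 2 → x 2 ≤ 1 → ∀ j : Fin 3,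
      ρp * deriv (fun s => vp s x j) t
          - μp * (∑ i : Fin 3, pd3 i (pd3 i (fun z => vp t z j)) x)
          + pd3 j (qp t) x = 0)
    (hmomm : ∀ t : ℝ, ∀ x : Fin 3 → ℝ, -b (x 0, x 1) ≤ x 2 → x 2 ≤ 0 → ∀ j : Fin 3,
      ρm * deriv (fun s => vm s x j) t
          - μm * (∑ i : Fin 3, pd3 i (pd3 i (fun z => vm t z j)) x)
          + pd3 j (qm t) x = 0)
    -- incompressibility
    (hdivp : ∀ t : ℝ, ∀ x : Fin 3 → ℝ, 0 ≤ x 2 → x 2 ≤ 1 →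
      (∑ i : Fin 3, pd3 i (fun z => vp t z i) x) = 0)
    (hdivm : ∀ t : ℝ, ∀ x : Fin 3 → ℝ, -b (x 0, x 1) ≤ x 2 → x 2 ≤ 0 →
      (∑ i : Fin 3, pd3 i (fun z => vm t z i) x) = 0)
    -- dynamic boundary condition with surface tension on Σ₊ = {x₃ = 1}
    (hbcp : ∀ t : ℝ, ∀ x : Fin 3 → ℝ, x 2 = 1 → ∀ j : Fin 3,
      qp t x * e₃ j
          - μp * (pd3 j (fun z => vp t z 2) x + pd3 2 (fun z => vp t z j) x)
        = (ρp * g * ζp t (x 0, x 1) - σp * lap2 (ζp t) (x 0, x 1)) * e₃ j)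
    -- continuity of the velocity and jump condition on Σ₋ = {x₃ = 0}
    (hcont : ∀ t : ℝ, ∀ x : Fin 3 → ℝ, x 2 = 0 → vp t x = vm t x)
    (hjump : ∀ t : ℝ, ∀ x : Fin 3 → ℝ, x 2 = 0 → ∀ j : Fin 3,
      (qp t x - qm t x) * e₃ j
          - (μp * (pd3 j (fun z => vp t z 2) x + pd3 2 (fun z => vp t z j) x)
              - μm * (pd3 j (fun z => vm t z 2) x + pd3 2 (fun z => vm t z j) x))
        = ((ρp - ρm) * g * ζm t (x 0, x 1) + σm * lap2 (ζm t) (x 0, x 1)) * e₃ j)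
    -- kinematic boundary conditions
    (hkinp : ∀ t : ℝ, ∀ p : ℝ × ℝ,
      deriv (fun s => ζp s p) t = vp t ![p.1, p.2, 1] 2)
    (hkinm : ∀ t : ℝ, ∀ p : ℝ × ℝ,
      deriv (fun s => ζm s p) t = vp t ![p.1, p.2, 0] 2)
    -- no-slip condition on the lower boundary
    (hbot : ∀ t : ℝ, ∀ p : ℝ × ℝ, vm t ![p.1, p.2, -b p] = 0) :
    ∀ t : ℝ,
      HasDerivAt (fun τ : ℝ =>
          (1 / 2) * (∫ x in upCell L₁ L₂, ρp * ∑ j : Fin 3, (vp τ x j) ^ 2)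
          + (1 / 2) * (∫ x in loCell L₁ L₂ b, ρm * ∑ j : Fin 3, (vm τ x j) ^ 2)
          + (1 / 2) * (∫ p in Qcell L₁ L₂,
              (ρp * g * (ζp τ p) ^ 2
                + σp * ((fderiv ℝ (ζp τ) p (1, 0)) ^ 2 + (fderiv ℝ (ζp τ) p (0, 1)) ^ 2)))
          + (1 / 2) * (∫ p in Qcell L₁ L₂,
              (-(ρp - ρm) * g * (ζm τ p) ^ 2
                + σm * ((fderiv ℝ (ζm τ) p (1, 0)) ^ 2 + (fderiv ℝ (ζm τ) p (0, 1)) ^ 2))))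
        (-((1 / 2) * (∫ x in upCell L₁ L₂, μp * ∑ i : Fin 3, ∑ j : Fin 3,
              (pd3 i (fun z => vp t z j) x + pd3 j (fun z => vp t z i) x) ^ 2))
          - (1 / 2) * (∫ x in loCell L₁ L₂ b, μm * ∑ i : Fin 3, ∑ j : Fin 3,
              (pd3 i (fun z => vm t z j) x + pd3 j (fun z => vm t z i) x) ^ 2))
        t := by
  intro t
  have hU := phase (a := fun _ => 0) (c := 1) hL₁ hL₂ contDiff_const (fun _ => one_pos)
    ⟨fun _ => rfl, fun _ => rfl⟩ ρp μp hvps hqps hvpper hqpper hmomp hdivp t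
  have hLo := phase (a := fun p => -b p) (c := 0) hL₁ hL₂ hb.neg
    (fun p => neg_lt_zero.2 (hbpos p))
    ⟨fun p => congrArg Neg.neg (hbper.1 p), fun p => congrArg Neg.neg (hbper.2 p)⟩ ρm μm hvms hqms hvmper hqmper
    hmomm hdivm t
  have hSp := surf hL₁ hL₂ hζps hζpper (ρp * g) σp t
  have hSm := surf hL₁ hL₂ hζms hζmper (-(ρp - ρm) * g) σm t
  refine (((hU.add hLo).add hSp).add hSm).congr_deriv ?_
  -- continuity of everything in sight
  have fp := fun i => (flux_sm (μ := μp) (slice_sm hvps t) (slice_sm hqps t) i).continuous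
  have fm := fun i => (flux_sm (μ := μm) (slice_sm hvms t) (slice_sm hqms t) i).continuous
  have cb : Continuous b := hb.continuous
  have tp : Continuous fun p => deriv (fun s => ζp s p) t := (slice_sm (sm_time hζps) t).continuous
  have tm : Continuous fun p => deriv (fun s => ζm s p) t := (slice_sm (sm_time hζms) t).continuous
  have zp := (slice_sm hζps t).continuous
  have zm := (slice_sm hζms t).continuous
  have lp := lap2_cont (slice_sm hζps t)
  have lm := lap2_cont (slice_sm hζms t)
  -- simplify the fluxes at the bottoms
  have hbz : ∀ i, ∀ p : ℝ × ℝ, flux μm (vm t) (qm t) i ![p.1, p.2, -b p] = 0 := by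
    intro i p
    simp [flux, hbot]
  simp only [hbz, fderiv_fun_const, Pi.zero_apply, zero_apply, zero_mul, mul_zero, sub_zero]
  have c1 : Continuous fun p : ℝ × ℝ => flux μp (vp t) (qp t) 2 ![p.1, p.2, 1]
    - flux μp (vp t) (qp t) 2 ![p.1, p.2, 0] := by fun_prop
  have c2 : Continuous fun p : ℝ × ℝ => flux μm (vm t) (qm t) 2 ![p.1, p.2, 0] := by fun_prop
  have c3 : Continuous fun p : ℝ × ℝ =>
    (ρp * g * ζp t p - σp * lap2 (ζp t) p) * deriv (fun s => ζp s p) t := by fun_prop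
  have c4 : Continuous fun p : ℝ × ℝ =>
    (-(ρp - ρm) * g * ζm t p - σm * lap2 (ζm t) p) * deriv (fun s => ζm s p) t := by fun_prop
  have hsum : (∫ p in Qcell L₁ L₂, (flux μp (vp t) (qp t) 2 ![p.1, p.2, 1]
        - flux μp (vp t) (qp t) 2 ![p.1, p.2, 0]))
      + (∫ p in Qcell L₁ L₂, flux μm (vm t) (qm t) 2 ![p.1, p.2, 0])
      + (∫ p in Qcell L₁ L₂,
          (ρp * g * ζp t p - σp * lap2 (ζp t) p) * deriv (fun s => ζp s p) t)
      + (∫ p in Qcell L₁ L₂,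
          (-(ρp - ρm) * g * ζm t p - σm * lap2 (ζm t) p) * deriv (fun s => ζm s p) t) = 0 := by
    refine Q_add4 c1 c2 c3 c4 fun p => ?_
    have hv := hcont t ![p.1, p.2, 0] rfl
    have b0 := hbcp t ![p.1, p.2, 1] rfl 0
    have b1 := hbcp t ![p.1, p.2, 1] rfl 1
    have b2 := hbcp t ![p.1, p.2, 1] rfl 2
    have j0 := hjump t ![p.1, p.2, 0] rfl 0
    have j1 := hjump t ![p.1, p.2, 0] rfl 1
    have j2 := hjump t ![p.1, p.2, 0] rfl 2
    have hp' : ∀ r : ℝ, ((![p.1, p.2, r] : Fin 3 → ℝ) 0, (![p.1, p.2, r] : Fin 3 → ℝ) 1) = p :=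
      fun r => rfl
    have e0 : e₃ 0 = 0 := by simp [e₃]
    have e1 : e₃ 1 = 0 := by simp [e₃]
    have e2 : e₃ 2 = 1 := by simp [e₃]
    simp only [hp', e0, e1, e2, mul_zero, mul_one] at b0 b1 b2 j0 j1 j2
    simp only [flux, Fin.sum_univ_three, hkinp, hkinm, ← hv]
    linear_combination (-vp t ![p.1, p.2, 1] 0) * b0 - vp t ![p.1, p.2, 1] 1 * b1
      - vp t ![p.1, p.2, 1] 2 * b2 + vp t ![p.1, p.2, 0] 0 * j0 + vp t ![p.1, p.2, 0] 1 * j1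
      + vp t ![p.1, p.2, 0] 2 * j2
  have hup : upCell L₁ L₂ = gcell L₁ L₂ (fun _ => 0) 1 := rfl
  have hlo : loCell L₁ L₂ b = gcell L₁ L₂ (fun p => -b p) 0 := rfl
  rw [hup, hlo]
  linear_combination hsum
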